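/- arXiv:2312.01033 — 3 statements merged into one kernel-verified Lean document; each statement's English description precedes it below -/
import Mathlib

section
/- Let (X,H,ν) be a categorical augmented rack with H cocommutative and X cocommutative, and let R : X⊗X → X⊗X be the R-matrix R(x⊗y) = y⁽¹⁾ ⊗ (x·ν(y⁽²⁾)). Define R_{2,2} : X⊗X⊗X⊗X → X⊗X⊗X⊗X by R_{2,2}(x₁⊗x₂⊗y₁⊗y₂) = y₁⁽¹⁾ ⊗ y₂⁽¹⁾ ⊗ x₁·(ν(y₁⁽²⁾)ν(y₂⁽²⁾)) ⊗ x₂·(ν(y₁⁽³⁾)ν(y₂⁽³⁾)). Then R_{2,2} = (1⊗R⊗1) ∘ (1⊗1⊗R) ∘ (R⊗1⊗1) ∘ (1⊗R⊗1). -/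
open TensorProduct

variable {k : Type*} [CommRing k] {H : Type*} [Ring H] [HopfAlgebra k H]
variable {X : Type*} [AddCommGroup X] [Module k X] [Coalgebra k X]

/-- `sandwich a` is the linear map `H ⊗ H → H` sending `g⁽¹⁾ ⊗ g⁽²⁾` to `S(g⁽¹⁾) * a * g⁽²⁾`. -/
noncomputable def sandwich (a : H) : H ⊗[k] H →ₗ[k] H :=
  LinearMap.mul' k H ∘ₗ
    LinearMap.rTensor H (LinearMap.mulRight k a ∘ₗ HopfAlgebra.antipode (R := k))

/-- `R ⊗ 1` as a map on `X ⊗ (X ⊗ X)`. -/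
noncomputable def rOne (R : X ⊗[k] X →ₗ[k] X ⊗[k] X) :
    X ⊗[k] (X ⊗[k] X) →ₗ[k] X ⊗[k] (X ⊗[k] X) :=
  (TensorProduct.assoc k X X X).toLinearMap ∘ₗ LinearMap.rTensor X R ∘ₗ
    (TensorProduct.assoc k X X X).symm.toLinearMap

/-- `1 ⊗ R ⊗ 1` as a map on `X ⊗ (X ⊗ (X ⊗ X))`. -/
noncomputable def oneROne (R : X ⊗[k] X →ₗ[k] X ⊗[k] X) :
    X ⊗[k] (X ⊗[k] (X ⊗[k] X)) →ₗ[k] X ⊗[k] (X ⊗[k] (X ⊗[k] X)) :=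
  LinearMap.lTensor X (rOne R)

/-- `1 ⊗ 1 ⊗ R` as a map on `X ⊗ (X ⊗ (X ⊗ X))`. -/
noncomputable def oneOneR (R : X ⊗[k] X →ₗ[k] X ⊗[k] X) :
    X ⊗[k] (X ⊗[k] (X ⊗[k] X)) →ₗ[k] X ⊗[k] (X ⊗[k] (X ⊗[k] X)) :=
  LinearMap.lTensor X (LinearMap.lTensor X R)

/-- `R ⊗ 1 ⊗ 1` as a map on `X ⊗ (X ⊗ (X ⊗ X))`. -/
noncomputable def ROneOne (R : X ⊗[k] X →ₗ[k] X ⊗[k] X) :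
    X ⊗[k] (X ⊗[k] (X ⊗[k] X)) →ₗ[k] X ⊗[k] (X ⊗[k] (X ⊗[k] X)) :=
  (TensorProduct.assoc k X X (X ⊗[k] X)).toLinearMap ∘ₗ LinearMap.rTensor (X ⊗[k] X) R ∘ₗ
    (TensorProduct.assoc k X X (X ⊗[k] X)).symm.toLinearMap

/-- `y ↦ y⁽¹⁾ ⊗ (ν(y⁽²⁾) ⊗ ν(y⁽³⁾))`. -/
noncomputable def sweedler3Nu (ν : X →ₗ[k] H) : X →ₗ[k] X ⊗[k] (H ⊗[k] H) :=
  LinearMap.lTensor X (TensorProduct.map ν ν) ∘ₗ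
    LinearMap.lTensor X (Coalgebra.comul (R := k)) ∘ₗ Coalgebra.comul (R := k)

/-- Iterated comultiplication in Sweedler form, splitting the left tensor factor. -/
theorem sweedler3Nu_eq_sum (ν : X →ₗ[k] H) (y : X) :
    sweedler3Nu ν y = ∑ i ∈ (Coalgebra.Repr.arbitrary k y).index,
      ∑ j ∈ (Coalgebra.Repr.arbitrary k ((Coalgebra.Repr.arbitrary k y).left i)).index,
        (Coalgebra.Repr.arbitrary k ((Coalgebra.Repr.arbitrary k y).left i)).left j ⊗ₜ[k]
          (ν ((Coalgebra.Repr.arbitrary k ((Coalgebra.Repr.arbitrary k y).left i)).right j) ⊗ₜ[k]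
            ν ((Coalgebra.Repr.arbitrary k y).right i)) := by
  have h : Coalgebra.comul (R := k) y = _ := (Coalgebra.Repr.arbitrary k y).eq.symm
  rw [sweedler3Nu, LinearMap.comp_apply, LinearMap.comp_apply, ← Coalgebra.coassoc_apply, h]
  simp only [map_sum, LinearMap.rTensor_tmul]
  refine Finset.sum_congr rfl fun i _ => ?_
  rw [← (Coalgebra.Repr.arbitrary k ((Coalgebra.Repr.arbitrary k y).left i)).eq]
  simp only [sum_tmul, map_sum, assoc_tmul, LinearMap.lTensor_tmul, map_tmul]

/-- for a categorical augmented rack `(X, H, ν)` with `H` and `X`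
cocommutative, the map `R_{2,2}(x₁⊗x₂⊗y₁⊗y₂) =
y₁⁽¹⁾ ⊗ y₂⁽¹⁾ ⊗ x₁·(ν(y₁⁽²⁾)ν(y₂⁽²⁾)) ⊗ x₂·(ν(y₁⁽³⁾)ν(y₂⁽³⁾))` equals
`(1⊗R⊗1) ∘ (1⊗1⊗R) ∘ (R⊗1⊗1) ∘ (1⊗R⊗1)` for the R-matrix
`R(x⊗y) = y⁽¹⁾ ⊗ (x·ν(y⁽²⁾))`. -/
theorem R22_decomposition
    (hcocommH : ∀ g : H, (TensorProduct.comm k H H) (Coalgebra.comul (R := k) g) =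
      Coalgebra.comul (R := k) g)
    (hcocommX : ∀ x : X, (TensorProduct.comm k X X) (Coalgebra.comul (R := k) x) =
      Coalgebra.comul (R := k) x)
    (act : X ⊗[k] H →ₗ[k] X)
    (hact_one : ∀ x : X, act (x ⊗ₜ (1 : H)) = x)
    (hact_mul : ∀ (x : X) (g h : H), act (act (x ⊗ₜ g) ⊗ₜ h) = act (x ⊗ₜ (g * h)))
    (hcompat : (Coalgebra.comul (R := k) (A := X)) ∘ₗ act =
      TensorProduct.map act act ∘ₗ (TensorProduct.tensorTensorTensorComm k X X H H).toLinearMap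
        ∘ₗ TensorProduct.map (Coalgebra.comul (R := k)) (Coalgebra.comul (R := k)))
    (hcounit : ∀ (x : X) (g : H),
      Coalgebra.counit (R := k) (act (x ⊗ₜ g)) =
        Coalgebra.counit (R := k) x * Coalgebra.counit (R := k) g)
    (ν : X →ₗ[k] H)
    (hν_comul : (Coalgebra.comul (R := k) (A := H)) ∘ₗ ν =
      TensorProduct.map ν ν ∘ₗ Coalgebra.comul (R := k))
    (hν_counit : (Coalgebra.counit (R := k) (A := H)) ∘ₗ ν = Coalgebra.counit (R := k))
    (hν_aug : ∀ (x : X) (g : H), ν (act (x ⊗ₜ g)) = sandwich (ν x) (Coalgebra.comul (R := k) g))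
    (R : X ⊗[k] X →ₗ[k] X ⊗[k] X)
    (hR : ∀ x y : X, R (x ⊗ₜ y) =
      LinearMap.lTensor X (act ∘ₗ LinearMap.lTensor X ν)
        ((TensorProduct.leftComm k X X X) (x ⊗ₜ Coalgebra.comul (R := k) y))) :
    ∀ x₁ x₂ y₁ y₂ : X,
      (oneROne R ∘ₗ oneOneR R ∘ₗ ROneOne R ∘ₗ oneROne R) (x₁ ⊗ₜ (x₂ ⊗ₜ (y₁ ⊗ₜ y₂))) =
        (TensorProduct.assoc k X X (X ⊗[k] X))
          (LinearMap.lTensor (X ⊗[k] X)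
              (TensorProduct.map (act ∘ₗ TensorProduct.mk k X H x₁)
                  (act ∘ₗ TensorProduct.mk k X H x₂) ∘ₗ
                TensorProduct.map (LinearMap.mul' k H) (LinearMap.mul' k H) ∘ₗ
                (TensorProduct.tensorTensorTensorComm k H H H H).toLinearMap)
            ((TensorProduct.tensorTensorTensorComm k X (H ⊗[k] H) X (H ⊗[k] H))
              (sweedler3Nu ν y₁ ⊗ₜ sweedler3Nu ν y₂))) := by
  have hR_sum : ∀ x y : X, R (x ⊗ₜ y) = ∑ i ∈ (Coalgebra.Repr.arbitrary k y).index,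
      (Coalgebra.Repr.arbitrary k y).left i ⊗ₜ[k]
        act (x ⊗ₜ ν ((Coalgebra.Repr.arbitrary k y).right i)) := by
    intro x y
    have h : Coalgebra.comul (R := k) y = _ := (Coalgebra.Repr.arbitrary k y).eq.symm
    rw [hR, h]
    simp only [tmul_sum, map_sum, leftComm_tmul, LinearMap.lTensor_tmul, LinearMap.comp_apply]
  intro x₁ x₂ y₁ y₂
  simp only [sweedler3Nu_eq_sum, oneROne, oneOneR, ROneOne, rOne, LinearMap.comp_apply,
    LinearEquiv.coe_coe, LinearMap.lTensor_tmul, LinearMap.rTensor_tmul, assoc_tmul,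
    assoc_symm_tmul, hR_sum, map_sum, sum_tmul, tmul_sum, tensorTensorTensorComm_tmul, map_tmul,
    mk_apply, LinearMap.mul'_apply, hact_mul]
  rw [Finset.sum_congr rfl fun _ _ => Finset.sum_comm, Finset.sum_comm]
  refine Finset.sum_congr rfl fun _ _ => ?_
  rw [Finset.sum_congr rfl fun _ _ => Finset.sum_comm, Finset.sum_comm]
end

section
/- Let (X,H,ν) be a categorical augmented rack with H cocommutative and X cocommutative, and let R : X⊗X → X⊗X be the R-matrix R(x⊗y) = y⁽¹⁾ ⊗ (x·ν(y⁽²⁾)). Then the first hexagon-type identity holds: for all x,y,z ∈ X, (1⊗R)∘(R⊗1)(x⊗y⊗z) = y⁽¹⁾ ⊗ z⁽¹⁾ ⊗ x·(ν(y⁽²⁾)ν(z⁽²⁾)); that is, the braiding R_{X,X⊗X}(x⊗(y⊗z)) = (y⊗z)⁽¹⁾ ⊗ x·ν₂((y⊗z)⁽²⁾), where ν₂(y⊗z)=ν(y)ν(z) and (y⊗z)⁽¹⁾⊗(y⊗z)⁽²⁾ denotes the tensor-product comultiplication of X⊗X, equals (1⊗R)∘(R⊗1). -/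
open TensorProduct

variable {k : Type*} [CommRing k] {H : Type*} [Ring H] [HopfAlgebra k H]
variable {X : Type*} [AddCommGroup X] [Module k X] [Coalgebra k X]

/-- first hexagon-type identity — for the R-matrix
`R(x⊗y) = y⁽¹⁾ ⊗ (x·ν(y⁽²⁾))` of a categorical augmented rack with `H` and `X`
cocommutative, `(1⊗R)∘(R⊗1)(x⊗y⊗z) = y⁽¹⁾ ⊗ z⁽¹⁾ ⊗ x·(ν(y⁽²⁾)ν(z⁽²⁾))`. -/
theorem hexagon_first
    (hcocommH : ∀ g : H, (TensorProduct.comm k H H) (Coalgebra.comul (R := k) g) =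
      Coalgebra.comul (R := k) g)
    (hcocommX : ∀ x : X, (TensorProduct.comm k X X) (Coalgebra.comul (R := k) x) =
      Coalgebra.comul (R := k) x)
    (act : X ⊗[k] H →ₗ[k] X)
    (hact_one : ∀ x : X, act (x ⊗ₜ (1 : H)) = x)
    (hact_mul : ∀ (x : X) (g h : H), act (act (x ⊗ₜ g) ⊗ₜ h) = act (x ⊗ₜ (g * h)))
    (hcompat : (Coalgebra.comul (R := k) (A := X)) ∘ₗ act =
      TensorProduct.map act act ∘ₗ (TensorProduct.tensorTensorTensorComm k X X H H).toLinearMap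
        ∘ₗ TensorProduct.map (Coalgebra.comul (R := k)) (Coalgebra.comul (R := k)))
    (hcounit : ∀ (x : X) (g : H),
      Coalgebra.counit (R := k) (act (x ⊗ₜ g)) =
        Coalgebra.counit (R := k) x * Coalgebra.counit (R := k) g)
    (ν : X →ₗ[k] H)
    (hν_comul : (Coalgebra.comul (R := k) (A := H)) ∘ₗ ν =
      TensorProduct.map ν ν ∘ₗ Coalgebra.comul (R := k))
    (hν_counit : (Coalgebra.counit (R := k) (A := H)) ∘ₗ ν = Coalgebra.counit (R := k))
    (hν_aug : ∀ (x : X) (g : H), ν (act (x ⊗ₜ g)) = sandwich (ν x) (Coalgebra.comul (R := k) g))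
    (R : X ⊗[k] X →ₗ[k] X ⊗[k] X)
    (hR : ∀ x y : X, R (x ⊗ₜ y) =
      LinearMap.lTensor X (act ∘ₗ LinearMap.lTensor X ν)
        ((TensorProduct.leftComm k X X X) (x ⊗ₜ Coalgebra.comul (R := k) y))) :
    ∀ x y z : X,
      (LinearMap.lTensor X R ∘ₗ rOne R) (x ⊗ₜ (y ⊗ₜ z)) =
        (TensorProduct.assoc k X X X)
          (LinearMap.lTensor (X ⊗[k] X)
              (act ∘ₗ TensorProduct.mk k X H x ∘ₗ LinearMap.mul' k H)
            ((TensorProduct.tensorTensorTensorComm k X H X H)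
              (((LinearMap.lTensor X ν ∘ₗ Coalgebra.comul (R := k)) y) ⊗ₜ
                ((LinearMap.lTensor X ν ∘ₗ Coalgebra.comul (R := k)) z)))) := by
  intro x y z
  have hR_sum (x y : X) (r : Coalgebra.Repr k y (X × X)) : R (x ⊗ₜ y) =
      ∑ i ∈ r.index, r.left i ⊗ₜ act (x ⊗ₜ ν (r.right i)) := by
    rw [hR, ← r.eq]
    simp [TensorProduct.tmul_sum]
  let ry := Coalgebra.Repr.arbitrary k y
  let rz := Coalgebra.Repr.arbitrary k z
  simp only [rOne, LinearMap.comp_apply, LinearEquiv.coe_coe, TensorProduct.assoc_symm_tmul,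
    LinearMap.rTensor_tmul, hR_sum x y ry, TensorProduct.sum_tmul, map_sum,
    TensorProduct.assoc_tmul, LinearMap.lTensor_tmul, hR_sum _ z rz, TensorProduct.tmul_sum,
    ← ry.eq, ← rz.eq, TensorProduct.tensorTensorTensorComm_tmul, LinearMap.mul'_apply,
    TensorProduct.mk_apply, hact_mul]
  exact Finset.sum_comm
end

section
/- Let (X,H,ν) be a categorical augmented rack with H cocommutative and X cocommutative, and let R : X⊗X → X⊗X be the R-matrix R(x⊗y) = y⁽¹⁾ ⊗ (x·ν(y⁽²⁾)). Then the second hexagon-type identity holds: for all x,y,z ∈ X, (R⊗1)∘(1⊗R)(x⊗y⊗z) = z⁽¹⁾ ⊗ (x·ν(z⁽²⁾)) ⊗ (y·ν(z⁽³⁾)); that is, the braiding R_{X⊗X,X}((x⊗y)⊗z) = z⁽¹⁾ ⊗ ((x⊗y)·ν(z⁽²⁾)), where (x⊗y)·h = (x·h⁽¹⁾)⊗(y·h⁽²⁾), equals (R⊗1)∘(1⊗R). -/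
open TensorProduct

variable {k : Type*} [CommRing k] {H : Type*} [Ring H] [HopfAlgebra k H]
variable {X : Type*} [AddCommGroup X] [Module k X] [Coalgebra k X]

/-- second hexagon-type identity — for the R-matrix
`R(x⊗y) = y⁽¹⁾ ⊗ (x·ν(y⁽²⁾))` of a categorical augmented rack with `H` and `X`
cocommutative, `(R⊗1)∘(1⊗R)(x⊗y⊗z) = z⁽¹⁾ ⊗ (x·ν(z⁽²⁾)) ⊗ (y·ν(z⁽³⁾))`. -/
theorem hexagon_second
    (hcocommH : ∀ g : H, (TensorProduct.comm k H H) (Coalgebra.comul (R := k) g) =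
      Coalgebra.comul (R := k) g)
    (hcocommX : ∀ x : X, (TensorProduct.comm k X X) (Coalgebra.comul (R := k) x) =
      Coalgebra.comul (R := k) x)
    (act : X ⊗[k] H →ₗ[k] X)
    (hact_one : ∀ x : X, act (x ⊗ₜ (1 : H)) = x)
    (hact_mul : ∀ (x : X) (g h : H), act (act (x ⊗ₜ g) ⊗ₜ h) = act (x ⊗ₜ (g * h)))
    (hcompat : (Coalgebra.comul (R := k) (A := X)) ∘ₗ act =
      TensorProduct.map act act ∘ₗ (TensorProduct.tensorTensorTensorComm k X X H H).toLinearMap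
        ∘ₗ TensorProduct.map (Coalgebra.comul (R := k)) (Coalgebra.comul (R := k)))
    (hcounit : ∀ (x : X) (g : H),
      Coalgebra.counit (R := k) (act (x ⊗ₜ g)) =
        Coalgebra.counit (R := k) x * Coalgebra.counit (R := k) g)
    (ν : X →ₗ[k] H)
    (hν_comul : (Coalgebra.comul (R := k) (A := H)) ∘ₗ ν =
      TensorProduct.map ν ν ∘ₗ Coalgebra.comul (R := k))
    (hν_counit : (Coalgebra.counit (R := k) (A := H)) ∘ₗ ν = Coalgebra.counit (R := k))
    (hν_aug : ∀ (x : X) (g : H), ν (act (x ⊗ₜ g)) = sandwich (ν x) (Coalgebra.comul (R := k) g))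
    (R : X ⊗[k] X →ₗ[k] X ⊗[k] X)
    (hR : ∀ x y : X, R (x ⊗ₜ y) =
      LinearMap.lTensor X (act ∘ₗ LinearMap.lTensor X ν)
        ((TensorProduct.leftComm k X X X) (x ⊗ₜ Coalgebra.comul (R := k) y))) :
    ∀ x y z : X,
      (rOne R ∘ₗ LinearMap.lTensor X R) (x ⊗ₜ (y ⊗ₜ z)) =
        LinearMap.lTensor X
            (TensorProduct.map (act ∘ₗ TensorProduct.mk k X H x)
              (act ∘ₗ TensorProduct.mk k X H y))
          (sweedler3Nu ν z) := by
  intro x y z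
  have key : ∀ t : X ⊗[k] X,
      rOne R (x ⊗ₜ (LinearMap.lTensor X (act ∘ₗ LinearMap.lTensor X ν)
          ((TensorProduct.leftComm k X X X) (y ⊗ₜ t)))) =
        LinearMap.lTensor X
          (TensorProduct.map (act ∘ₗ TensorProduct.mk k X H x)
            (act ∘ₗ TensorProduct.mk k X H y))
          (LinearMap.lTensor X (TensorProduct.map ν ν)
            (TensorProduct.assoc k X X X
              (LinearMap.rTensor X (Coalgebra.comul (R := k)) t))) := by
    intro t
    induction t with
    | zero => simp
    | add s t hs ht => simp only [tmul_add, map_add, hs, ht]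
    | tmul a b =>
      simp only [rOne, LinearMap.comp_apply, LinearEquiv.coe_coe, leftComm_tmul,
        LinearMap.lTensor_tmul, LinearMap.rTensor_tmul, assoc_symm_tmul, hR]
      generalize Coalgebra.comul (R := k) a = s
      induction s with
      | zero => simp
      | add s t hs ht => simp only [tmul_add, add_tmul, map_add, hs, ht]
      | tmul c d => simp
  simp only [LinearMap.comp_apply, LinearMap.lTensor_tmul, sweedler3Nu, hR, key,
    Coalgebra.coassoc_apply]
end
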